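/- arXiv:2011.07450 — 4 statements merged into one kernel-verified Lean document; each statement's English description precedes it below -/
import Mathlib

section
/- Let (x_n)_{n∈ℕ} be a sequence of nonnegative real numbers, let B ∈ ℕ, and let γ > 1. Suppose that for every integer n > B one has x_n ≤ (γ/n)·(1 + Σ_{j=0}^{n−1} x_j). Then there exists c > 0 such that x_n ≤ c·γⁿ for all n ∈ ℕ. -/
/-- **Growth estimate for a nonnegative sequence dominated by `γ/n` times
`1` plus its partial sums** (key inductive estimate in the proof of Lemma A.2):
if `x : ℕ → ℝ` is nonnegative, `B : ℕ`, `γ > 1`, and for every `n > B` we have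
`x n ≤ (γ/n) * (1 + ∑_{j<n} x j)`, then there is `c > 0` with `x n ≤ c * γ^n` for all `n`. -/
theorem stmt_3 (x : ℕ → ℝ) (hx : ∀ n, 0 ≤ x n) (B : ℕ) (γ : ℝ) (hγ : 1 < γ)
    (h : ∀ n : ℕ, B < n → x n ≤ (γ / n) * (1 + ∑ j ∈ Finset.range n, x j)) :
    ∃ c > 0, ∀ n : ℕ, x n ≤ c * γ ^ n := by
  obtain ⟨K, hK⟩ := exists_nat_gt (γ / (γ - 1))
  set S : ℕ → ℝ := fun n => 1 + ∑ j ∈ Finset.range n, x j with hS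
  have hsucc : ∀ n, S (n + 1) = S n + x n := fun n => by
    simp only [hS, Finset.sum_range_succ, add_assoc]
  have hmono : Monotone S := monotone_nat_of_le_succ fun n => by
    rw [hsucc]; exact le_add_of_nonneg_right (hx n)
  have hone : ∀ n, 1 ≤ S n := fun n =>
    le_add_of_nonneg_right (Finset.sum_nonneg fun j _ => hx j)
  have hstep : ∀ n, max K (B + 1) ≤ n → S (n + 1) ≤ γ * S n := by
    intro n hn
    have hKn : (K : ℝ) ≤ n := by exact_mod_cast (le_max_left _ _).trans hn
    have hBn : B < n := (le_max_right K (B + 1)).trans hn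
    have hn0 : (0 : ℝ) < n := by exact_mod_cast B.zero_le.trans_lt hBn
    have hratio : γ / n ≤ γ - 1 := by
      rw [div_le_comm₀ hn0 (sub_pos.2 hγ)]
      exact hK.le.trans hKn
    calc S (n + 1) = S n + x n := hsucc n
      _ ≤ S n + (γ - 1) * S n := by
        gcongr
        exact (h n hBn).trans
          (mul_le_mul_of_nonneg_right hratio (zero_le_one.trans (hone n)))
      _ = γ * S n := by ring
  set N := max K (B + 1)
  have hNpos : 0 < S N := zero_lt_one.trans_le (hone N)
  have hbound : ∀ n, S n ≤ S N * γ ^ n := by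
    intro n
    rcases le_total n N with hn | hn
    · exact (hmono hn).trans (le_mul_of_one_le_right hNpos.le (one_le_pow₀ hγ.le))
    · induction n, hn using Nat.le_induction with
      | base => exact le_mul_of_one_le_right hNpos.le (one_le_pow₀ hγ.le)
      | succ n hn ih =>
        calc S (n + 1) ≤ γ * S n := hstep n hn
          _ ≤ γ * (S N * γ ^ n) := by gcongr
          _ = S N * γ ^ (n + 1) := by ring
  refine ⟨S N * γ, by positivity, fun n => ?_⟩
  calc x n ≤ S (n + 1) := by
        rw [hsucc]; exact le_add_of_nonneg_left (zero_le_one.trans (hone n))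
    _ ≤ S N * γ ^ (n + 1) := hbound (n + 1)
    _ = S N * γ * γ ^ n := by ring
end

section
/- Let N ∈ ℕ and α, r > 0. Let (A_n)_{n∈ℕ} be a sequence of N×N complex matrices with operator norm ‖A_n‖ ≤ α·r^{−n} for all n, and let (ω_n)_{n∈ℕ}, (ψ_n)_{n∈ℕ} be sequences in ℂ^N with ‖ω_n‖ ≤ α·r^{−n} for all n, satisfying the recursion n·ψ_n = ω_n + Σ_{j=0}^{n} A_{n−j} ψ_j for every n ∈ ℕ. Then there exist c > 0 and γ ≥ 1 such that ‖ψ_n‖ ≤ c·γⁿ·r^{−n} for all n ∈ ℕ; in particular, there exists s > 0 with Σ_{n∈ℕ} ‖ψ_n‖·sⁿ < ∞, i.e., the power series Σ_n ψ_n qⁿ has positive radius of convergence. -/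
/-- A nonnegative sequence with `n xₙ ≤ α (1 + ∑_{j ≤ n} xⱼ)` grows at most like `2ⁿ`. -/
theorem exists_le_mul_two_pow_of_mul_le_sum {α : ℝ} (hα : 0 < α) {x : ℕ → ℝ}
    (hx : ∀ n, 0 ≤ x n)
    (h : ∀ n : ℕ, n * x n ≤ α * (1 + ∑ j ∈ Finset.range (n + 1), x j)) :
    ∃ c > 0, ∀ n, x n ≤ c * 2 ^ n := by
  obtain ⟨M, hM⟩ := exists_nat_ge (2 * α)
  set S : ℕ → ℝ := fun n => 1 + ∑ j ∈ Finset.range n, x j with hS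
  have hsucc (n : ℕ) : S (n + 1) = S n + x n := by
    simp only [hS, Finset.sum_range_succ]; ring
  have hpos (n : ℕ) : 0 < S n :=
    add_pos_of_pos_of_nonneg one_pos (Finset.sum_nonneg fun j _ => hx j)
  have hmono : Monotone S := monotone_nat_of_le_succ fun n => by
    rw [hsucc]; linarith [hx n]
  have hstep (n : ℕ) (hn : M ≤ n) : x n ≤ S n := by
    have h1 : n * x n ≤ α * S (n + 1) := h n
    have hn' : 2 * α ≤ n := hM.trans (by exact_mod_cast hn)
    have h2 : 2 * α * x n ≤ n * x n := mul_le_mul_of_nonneg_right hn' (hx n)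
    rw [hsucc] at h1
    exact le_of_mul_le_mul_left (by linarith) hα
  have hgrowth (n : ℕ) : S n ≤ S M * 2 ^ n := by
    induction n with
    | zero => simpa using hmono (Nat.zero_le M)
    | succ n ih =>
      rcases lt_or_ge n M with hn | hn
      · exact (hmono hn).trans (le_mul_of_one_le_right (hpos M).le (one_le_pow₀ one_le_two))
      · rw [hsucc, pow_succ]
        linarith [hstep n hn]
  refine ⟨2 * S M, by linarith [hpos M], fun n => ?_⟩
  have h1 := hgrowth (n + 1)
  rw [pow_succ, hsucc] at h1
  linarith [hpos n]

/-- **Geometric growth of the coefficients of a formal solution of `q∂_qψ = Aψ + ω`**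
(quantitative core of the proof of Lemma A.2): if `‖A_n‖ ≤ α/rⁿ` (operator norm) and
`‖ω_n‖ ≤ α/rⁿ`, and `n·ψ_n = ω_n + ∑_{j=0}^n A_{n−j} ψ_j` for all `n`, then
`‖ψ_n‖ ≤ c·γⁿ/rⁿ` for some `c > 0`, `γ ≥ 1`; in particular `∑ ‖ψ_n‖ sⁿ < ∞` for some `s > 0`. -/
theorem stmt_4 (N : ℕ) (α r : ℝ) (hα : 0 < α) (hr : 0 < r)
    (A : ℕ → (EuclideanSpace ℂ (Fin N) →L[ℂ] EuclideanSpace ℂ (Fin N)))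
    (ω ψ : ℕ → EuclideanSpace ℂ (Fin N))
    (hA : ∀ n : ℕ, ‖A n‖ ≤ α / r ^ n) (hω : ∀ n : ℕ, ‖ω n‖ ≤ α / r ^ n)
    (hrec : ∀ n : ℕ, (n : ℂ) • ψ n = ω n + ∑ j ∈ Finset.range (n + 1), A (n - j) (ψ j)) :
    (∃ c > 0, ∃ γ ≥ (1 : ℝ), ∀ n : ℕ, ‖ψ n‖ ≤ c * γ ^ n / r ^ n) ∧
      ∃ s > 0, Summable fun n : ℕ => ‖ψ n‖ * s ^ n := by
  have hx (n : ℕ) : 0 ≤ ‖ψ n‖ * r ^ n := by positivity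
  have hbound (n : ℕ) : n * (‖ψ n‖ * r ^ n) ≤
      α * (1 + ∑ j ∈ Finset.range (n + 1), ‖ψ j‖ * r ^ j) := by
    have hterm (j : ℕ) (hj : j ∈ Finset.range (n + 1)) :
        ‖A (n - j) (ψ j)‖ ≤ α * (‖ψ j‖ * r ^ j) / r ^ n := by
      have hjn : j ≤ n := Nat.lt_succ_iff.mp (Finset.mem_range.mp hj)
      calc ‖A (n - j) (ψ j)‖ ≤ α / r ^ (n - j) * ‖ψ j‖ := (A (n - j)).le_of_opNorm_le (hA _) _
        _ = α * (‖ψ j‖ * r ^ j) / r ^ n := by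
          rw [← pow_sub_mul_pow r hjn]
          field_simp
    have hnorm : n * ‖ψ n‖ ≤
        α / r ^ n + ∑ j ∈ Finset.range (n + 1), α * (‖ψ j‖ * r ^ j) / r ^ n := by
      calc n * ‖ψ n‖ = ‖(n : ℂ) • ψ n‖ := by simp [norm_smul]
        _ ≤ _ := by
          rw [hrec n]
          exact norm_add_le_of_le (hω n) (norm_sum_le_of_le _ hterm)
    rw [← Finset.sum_div, ← Finset.mul_sum, ← add_div, le_div_iff₀ (by positivity)] at hnorm
    linarith
  obtain ⟨c, hc, hgrowth⟩ := exists_le_mul_two_pow_of_mul_le_sum hα hx hbound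
  refine ⟨⟨c, hc, 2, one_le_two, fun n => (le_div_iff₀ (by positivity)).mpr (hgrowth n)⟩,
    r / 4, by positivity, ?_⟩
  refine Summable.of_nonneg_of_le (fun n => by positivity) (fun n => ?_)
    (summable_geometric_two.mul_left c)
  calc ‖ψ n‖ * (r / 4) ^ n = ‖ψ n‖ * r ^ n * (1 / 4) ^ n := by
        rw [mul_assoc, ← mul_pow, mul_one_div]
    _ ≤ c * 2 ^ n * (1 / 4) ^ n := mul_le_mul_of_nonneg_right (hgrowth n) (by positivity)
    _ = c * (1 / 2) ^ n := by rw [mul_assoc, ← mul_pow]; norm_num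
end

section
/- Let U ⊆ ℂ be open and let η, μ, f : U → ℂ be injective holomorphic functions, each with nowhere-vanishing derivative on U (so each has a holomorphic inverse defined on its open image). Then for every z ∈ U: S(f∘μ⁻¹)(μ(z))·μ'(z)² + S(η∘f⁻¹)(f(z))·f'(z)² + S(μ∘η⁻¹)(η(z))·η'(z)² = 0. -/
/-- The Schwarzian derivative `S f = f'''/f' - (3/2)(f''/f')²` of a function `f : ℂ → ℂ`. -/
noncomputable def schwarzian (f : ℂ → ℂ) (z : ℂ) : ℂ :=
  iteratedDeriv 3 f z / deriv f z - (3 / 2) * (iteratedDeriv 2 f z / deriv f z) ^ 2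

open Filter Topology in
/-- First derivative of a composition of analytic functions, near a point. -/
theorem AnalyticAt.eventuallyEq_deriv_comp {g h : ℂ → ℂ} {z : ℂ}
    (hg : AnalyticAt ℂ g (h z)) (hh : AnalyticAt ℂ h z) :
    deriv (g ∘ h) =ᶠ[𝓝 z] fun x => deriv g (h x) * deriv h x := by
  filter_upwards [hh.continuousAt.eventually hg.eventually_analyticAt,
    hh.eventually_analyticAt] with x hgx hhx
  exact deriv_comp x hgx.differentiableAt hhx.differentiableAt

open Filter Topology in
/-- Second derivative of a composition of analytic functions, near a point. -/
theorem AnalyticAt.eventuallyEq_deriv_deriv_comp {g h : ℂ → ℂ} {z : ℂ}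
    (hg : AnalyticAt ℂ g (h z)) (hh : AnalyticAt ℂ h z) :
    deriv (deriv (g ∘ h)) =ᶠ[𝓝 z] fun x =>
      deriv (deriv g) (h x) * deriv h x ^ 2 + deriv g (h x) * deriv (deriv h) x := by
  filter_upwards [(hg.eventuallyEq_deriv_comp hh).eventuallyEq_nhds,
    hh.continuousAt.eventually hg.eventually_analyticAt,
    hh.eventually_analyticAt] with x hx hgx hhx
  have h₁ := hgx.deriv.differentiableAt.hasDerivAt.comp x hhx.differentiableAt.hasDerivAt
  have h₂ := h₁.mul hhx.deriv.differentiableAt.hasDerivAt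
  rw [hx.deriv_eq]
  refine Eq.trans h₂.deriv ?_
  simp only [Function.comp_apply]
  ring

/-- Third derivative of a composition of analytic functions. -/
theorem AnalyticAt.deriv_deriv_deriv_comp {g h : ℂ → ℂ} {z : ℂ}
    (hg : AnalyticAt ℂ g (h z)) (hh : AnalyticAt ℂ h z) :
    deriv (deriv (deriv (g ∘ h))) z =
      deriv (deriv (deriv g)) (h z) * deriv h z ^ 3
        + 3 * deriv (deriv g) (h z) * deriv h z * deriv (deriv h) z
        + deriv g (h z) * deriv (deriv (deriv h)) z := by
  have hd := hh.differentiableAt.hasDerivAt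
  have hd' := hh.deriv.differentiableAt.hasDerivAt
  have hd'' := hh.deriv.deriv.differentiableAt.hasDerivAt
  have h₁ := hg.deriv.differentiableAt.hasDerivAt.comp z hd
  have h₂ := hg.deriv.deriv.differentiableAt.hasDerivAt.comp z hd
  have h₃ := (h₂.mul (hd'.pow 2)).add (h₁.mul hd'')
  rw [(hg.eventuallyEq_deriv_deriv_comp hh).deriv_eq]
  refine Eq.trans h₃.deriv ?_
  simp only [Function.comp_apply, Pi.pow_apply]
  push_cast
  ring

/-- The Schwarzian derivative in terms of iterated `deriv`. -/
theorem schwarzian_eq_deriv (f : ℂ → ℂ) (z : ℂ) :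
    schwarzian f z = deriv (deriv (deriv f)) z / deriv f z
      - (3 / 2) * (deriv (deriv f) z / deriv f z) ^ 2 := by
  simp only [schwarzian, iteratedDeriv_succ, iteratedDeriv_zero]

/-- Chain rule for the Schwarzian derivative. -/
theorem schwarzian_comp {g h : ℂ → ℂ} {z : ℂ}
    (hg : AnalyticAt ℂ g (h z)) (hh : AnalyticAt ℂ h z)
    (hg' : deriv g (h z) ≠ 0) (hh' : deriv h z ≠ 0) :
    schwarzian (g ∘ h) z = schwarzian g (h z) * deriv h z ^ 2 + schwarzian h z := by
  simp only [schwarzian_eq_deriv]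
  rw [hg.deriv_deriv_deriv_comp hh, (hg.eventuallyEq_deriv_deriv_comp hh).eq_of_nhds,
    (hg.eventuallyEq_deriv_comp hh).eq_of_nhds]
  field_simp
  ring

open Filter Topology in
/-- The Schwarzian derivative depends only on the germ of the function. -/
theorem Filter.EventuallyEq.schwarzian_eq {f g : ℂ → ℂ} {z : ℂ} (h : f =ᶠ[𝓝 z] g) :
    schwarzian f z = schwarzian g z := by
  rw [schwarzian_eq_deriv, schwarzian_eq_deriv, h.deriv.deriv.deriv_eq, h.deriv.deriv_eq,
    h.deriv_eq]

open Filter Topology in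
/-- The Schwarzian derivative of `f` with respect to a coordinate `μ` is the difference of the
Schwarzian derivatives of `f` and `μ`. -/
theorem schwarzian_comp_leftInverse {U : Set ℂ} (hU : IsOpen U) {f μ μInv : ℂ → ℂ}
    (hf : DifferentiableOn ℂ f U) (hμ : DifferentiableOn ℂ μ U)
    (hμInv : DifferentiableOn ℂ μInv (μ '' U)) (hμi : ∀ z ∈ U, μInv (μ z) = z)
    {z : ℂ} (hz : z ∈ U) (hf' : deriv f z ≠ 0) (hμ' : deriv μ z ≠ 0) :
    schwarzian (f ∘ μInv) (μ z) * deriv μ z ^ 2 = schwarzian f z - schwarzian μ z := by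
  have hUz : U ∈ 𝓝 z := hU.mem_nhds hz
  have hμa : AnalyticAt ℂ μ z := hμ.analyticAt hUz
  have himage : μ '' U ∈ 𝓝 (μ z) := by
    rw [← hμa.hasStrictDerivAt.map_nhds_eq hμ']
    exact image_mem_map hUz
  have hfa : AnalyticAt ℂ f (μInv (μ z)) := by
    rw [hμi z hz]
    exact hf.analyticAt hUz
  have hga : AnalyticAt ℂ (f ∘ μInv) (μ z) := hfa.comp (hμInv.analyticAt himage)
  have heq : (f ∘ μInv) ∘ μ =ᶠ[𝓝 z] f := by
    filter_upwards [hUz] with x hx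
    simp only [Function.comp_apply, hμi x hx]
  have hg' : deriv (f ∘ μInv) (μ z) ≠ 0 := by
    have hd := (hga.eventuallyEq_deriv_comp hμa).eq_of_nhds
    rw [heq.deriv_eq] at hd
    exact left_ne_zero_of_mul (hd ▸ hf')
  rw [← heq.schwarzian_eq, schwarzian_comp hga hμa hg' hμ', add_sub_cancel_right]

/-- **Cocycle relation for Schwarzian derivatives** (eq. (8.4) of the paper):
for injective holomorphic functions `η, μ, f` on an open set `U`, each with
nowhere-vanishing derivative and with holomorphic inverses `ηInv, μInv, fInv` on
their open images, one has, at every `z ∈ U`,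
`S_μ f · μ'(z)² + S_f η · f'(z)² + S_η μ · η'(z)² = 0`,
where `S_μ f = S(f∘μ⁻¹)(μ(z))`, etc. -/
theorem stmt_7 (U : Set ℂ) (hU : IsOpen U) (η μ f ηInv μInv fInv : ℂ → ℂ)
    (hη : DifferentiableOn ℂ η U) (hηinj : Set.InjOn η U) (hη' : ∀ z ∈ U, deriv η z ≠ 0)
    (hμ : DifferentiableOn ℂ μ U) (hμinj : Set.InjOn μ U) (hμ' : ∀ z ∈ U, deriv μ z ≠ 0)
    (hf : DifferentiableOn ℂ f U) (hfinj : Set.InjOn f U) (hf' : ∀ z ∈ U, deriv f z ≠ 0)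
    (hηInv : DifferentiableOn ℂ ηInv (η '' U)) (hηi : ∀ z ∈ U, ηInv (η z) = z)
    (hμInv : DifferentiableOn ℂ μInv (μ '' U)) (hμi : ∀ z ∈ U, μInv (μ z) = z)
    (hfInv : DifferentiableOn ℂ fInv (f '' U)) (hfi : ∀ z ∈ U, fInv (f z) = z) :
    ∀ z ∈ U,
      schwarzian (f ∘ μInv) (μ z) * (deriv μ z) ^ 2 +
        schwarzian (η ∘ fInv) (f z) * (deriv f z) ^ 2 +
        schwarzian (μ ∘ ηInv) (η z) * (deriv η z) ^ 2 = 0 := by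
  intro z hz
  rw [schwarzian_comp_leftInverse hU hf hμ hμInv hμi hz (hf' z hz) (hμ' z hz),
    schwarzian_comp_leftInverse hU hη hf hfInv hfi hz (hη' z hz) (hf' z hz),
    schwarzian_comp_leftInverse hU hμ hη hηInv hηi hz (hμ' z hz) (hη' z hz)]
  ring
end

section
/- Let U ⊆ ℂ be open, let Q : U → ℂ be holomorphic, and let x ∈ U. Then there exist an open set V with x ∈ V ⊆ U and a holomorphic function f : V → ℂ with f'(z) ≠ 0 for all z ∈ V, such that S f(z) = Q(z) for every z ∈ V. -/
open Metric in
/-- Local existence for the linear differential equation `w' = A w` with holomorphic coefficients. -/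
theorem exists_hasDerivAt_of_differentiableOn_clm {E : Type*} [NormedAddCommGroup E]
    [NormedSpace ℂ E] [CompleteSpace E] {U : Set ℂ} (hU : IsOpen U) {A : ℂ → E →L[ℂ] E}
    (hA : DifferentiableOn ℂ A U) {x : ℂ} (hx : x ∈ U) (w₀ : E) :
    ∃ r > 0, ball x r ⊆ U ∧ ∃ w : ℂ → E, w x = w₀ ∧
      ∀ z ∈ ball x r, HasDerivAt w (A z (w z)) z := by
  have hAx : ContinuousAt A x := (hA.differentiableAt (hU.mem_nhds hx)).continuousAt
  set M : ℝ := ‖A x‖ + 1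
  have hM : 0 < M := by positivity
  have hbound : ∀ᶠ z in nhds x, ‖A z‖ < M := hAx.norm.eventually_lt_const (by simp [M])
  obtain ⟨ε, hε, hεU⟩ := Metric.eventually_nhds_iff_ball.1 (hbound.and (hU.mem_nhds hx))
  set r : ℝ := min ε (1 / (2 * M))
  have hr : 0 < r := by positivity
  have hrM : M * r ≤ 1 / 2 :=
    calc M * r ≤ M * (1 / (2 * M)) := by gcongr; exact min_le_right _ _
      _ = 1 / 2 := by field_simp
  have hball : ∀ z ∈ ball x r, ‖A z‖ < M ∧ z ∈ U :=
    fun z hz => hεU z (ball_subset_ball (min_le_left _ _) hz)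
  have hrU : ball x r ⊆ U := fun z hz => (hball z hz).2
  have hxr : x ∈ ball x r := mem_ball_self hr
  have hstep : ∀ g : ℂ → E, DifferentiableOn ℂ g (ball x r) → ∃ p : ℂ → E, p x = 0 ∧
      ∀ z ∈ ball x r, HasDerivAt p (A z (g z)) z := fun g hg =>
    ((hA.mono hrU).clm_apply hg).isExactOn_ball.with_val_at x 0
  choose! T hT₀ hT using hstep
  let F : ℕ → ℂ → E := fun n => T^[n] fun _ => w₀
  have hFsucc : ∀ n, F (n + 1) = T (F n) := fun n => Function.iterate_succ_apply' T n _
  have hFdiff : ∀ n, DifferentiableOn ℂ (F n) (ball x r) := by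
    intro n
    induction n with
    | zero => exact differentiableOn_const _
    | succ n ih =>
      rw [hFsucc]
      exact fun z hz => (hT _ ih z hz).differentiableAt.differentiableWithinAt
  have hFderiv : ∀ n, ∀ z ∈ ball x r, HasDerivAt (F (n + 1)) (A z (F n z)) z := by
    intro n
    rw [hFsucc]
    exact hT _ (hFdiff n)
  have hFx : ∀ n, F (n + 1) x = 0 := by
    intro n
    rw [hFsucc]
    exact hT₀ _ (hFdiff n)
  have hFle : ∀ n, ∀ z ∈ ball x r, ‖F n z‖ ≤ ‖w₀‖ * (1 / 2) ^ n := by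
    intro n
    induction n with
    | zero => simp [F]
    | succ n ih =>
      intro z hz
      have h := (convex_ball x r).norm_image_sub_le_of_norm_hasDerivWithin_le
        (C := M * (‖w₀‖ * (1 / 2) ^ n)) (fun y hy => (hFderiv n y hy).hasDerivWithinAt)
        (fun y hy => (A y).le_of_opNorm_le_of_le (hball y hy).1.le (ih y hy)) hxr hz
      rw [hFx, sub_zero] at h
      calc ‖F (n + 1) z‖ ≤ M * (‖w₀‖ * (1 / 2) ^ n) * ‖z - x‖ := h
        _ ≤ M * (‖w₀‖ * (1 / 2) ^ n) * r := by
          gcongr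
          exact (mem_ball_iff_norm.1 hz).le
        _ = ‖w₀‖ * (1 / 2) ^ n * (M * r) := by ring
        _ ≤ ‖w₀‖ * (1 / 2) ^ n * (1 / 2) := by gcongr
        _ = ‖w₀‖ * (1 / 2) ^ (n + 1) := by ring
  have hu : Summable fun n : ℕ => ‖w₀‖ * (1 / 2 : ℝ) ^ n := summable_geometric_two.mul_left _
  refine ⟨r, hr, hrU, fun z => ∑' n, F n z, ?_, fun z hz => ?_⟩
  · refine (tsum_eq_single 0 fun n hn => ?_).trans rfl
    obtain ⟨m, rfl⟩ := Nat.exists_eq_succ_of_ne_zero hn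
    exact hFx m
  · have hsum : Summable fun n => F n z :=
      Summable.of_norm_bounded hu fun n => hFle n z hz
    have hd : HasSum (fun n => deriv (F n) z) (deriv (fun w => ∑' n, F n w) z) :=
      Complex.hasSum_deriv_of_summable_norm hu hFdiff isOpen_ball hFle hz
    have hd' : HasSum (fun n => deriv (F n) z) (A z (∑' n, F n z)) := by
      rw [← hasSum_nat_add_iff' 1]
      have hF₀ : deriv (F 0) z = 0 := deriv_const z w₀
      simpa only [(hFderiv _ z hz).deriv, Finset.sum_range_one, hF₀, sub_zero] using
        (A z).hasSum hsum.hasSum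
    rw [← hd.unique hd']
    exact ((Complex.differentiableOn_tsum_of_summable_norm hu hFdiff isOpen_ball
      hFle).differentiableAt (isOpen_ball.mem_nhds hz)).hasDerivAt

/-- If `h'' = c h` near `z`, then a primitive of `h⁻²` has Schwarzian derivative `-2 * c` at `z`. -/
theorem schwarzian_eq_of_hasDerivAt_inv_sq {f h k : ℂ → ℂ} {V : Set ℂ} (hV : IsOpen V)
    (hf : ∀ z ∈ V, HasDerivAt f (h z ^ 2)⁻¹ z) (hh : ∀ z ∈ V, HasDerivAt h (k z) z)
    (hne : ∀ z ∈ V, h z ≠ 0) {z c : ℂ} (hz : z ∈ V) (hk : HasDerivAt k (c * h z) z) :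
    schwarzian f z = -2 * c := by
  have hf₂ : ∀ y ∈ V, HasDerivAt (deriv f) (-2 * k y / h y ^ 3) y := by
    intro y hy
    have hy₀ := hne y hy
    have hd : deriv f =ᶠ[nhds y] fun t => (h t ^ 2)⁻¹ :=
      Filter.eventually_of_mem (hV.mem_nhds hy) fun t ht => (hf t ht).deriv
    refine HasDerivAt.congr_of_eventuallyEq ?_ hd
    refine (((hh y hy).fun_pow 2).fun_inv (pow_ne_zero 2 hy₀)).congr_deriv ?_
    field_simp
    push_cast
    ring
  have hz₀ := hne z hz
  have hf₃ : HasDerivAt (deriv (deriv f)) (-2 * c / h z ^ 2 + 6 * k z ^ 2 / h z ^ 4) z := by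
    have hd : deriv (deriv f) =ᶠ[nhds z] fun t => -2 * k t / h t ^ 3 :=
      Filter.eventually_of_mem (hV.mem_nhds hz) fun t ht => (hf₂ t ht).deriv
    refine HasDerivAt.congr_of_eventuallyEq ?_ hd
    refine ((hk.const_mul (-2)).fun_div ((hh z hz).fun_pow 3) (pow_ne_zero 3 hz₀)).congr_deriv ?_
    field_simp
    push_cast
    ring
  have h₂ : iteratedDeriv 2 f z = -2 * k z / h z ^ 3 := by
    rw [iteratedDeriv_succ, iteratedDeriv_one, (hf₂ z hz).deriv]
  have h₃ : iteratedDeriv 3 f z = -2 * c / h z ^ 2 + 6 * k z ^ 2 / h z ^ 4 := by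
    rw [iteratedDeriv_succ, iteratedDeriv_succ, iteratedDeriv_one, hf₃.deriv]
  rw [schwarzian, h₂, h₃, (hf z hz).deriv]
  field_simp
  ring

/-- **Local solvability of the Schwarzian equation** (Proposition 8.4 (2) of the paper):
for any holomorphic `Q` on an open set `U ⊆ ℂ` and any `x ∈ U`, there are an open
neighbourhood `V` of `x` contained in `U` and a holomorphic `f` on `V` with
nowhere-vanishing derivative such that `S f = Q` on `V`. -/
theorem stmt_9 (U : Set ℂ) (hU : IsOpen U) (Q : ℂ → ℂ) (hQ : DifferentiableOn ℂ Q U)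
    (x : ℂ) (hx : x ∈ U) :
    ∃ V : Set ℂ, IsOpen V ∧ x ∈ V ∧ V ⊆ U ∧
      ∃ f : ℂ → ℂ, DifferentiableOn ℂ f V ∧ (∀ z ∈ V, deriv f z ≠ 0) ∧
        ∀ z ∈ V, schwarzian f z = Q z := by
  let A : ℂ → (ℂ × ℂ) →L[ℂ] (ℂ × ℂ) := fun z =>
    (ContinuousLinearMap.inl ℂ ℂ ℂ).comp (ContinuousLinearMap.snd ℂ ℂ ℂ) +
      (-Q z / 2) • (ContinuousLinearMap.inr ℂ ℂ ℂ).comp (ContinuousLinearMap.fst ℂ ℂ ℂ)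
  have hA : DifferentiableOn ℂ A U :=
    (differentiableOn_const _).add ((hQ.neg.div_const 2).smul_const _)
  obtain ⟨r, hr, hrU, w, hwx, hw⟩ := exists_hasDerivAt_of_differentiableOn_clm hU hA hx (1, 0)
  have hh : ∀ z ∈ Metric.ball x r, HasDerivAt (fun t => (w t).1) (w z).2 z := fun z hz => by
    simpa [A] using (hw z hz).hasFDerivAt.fst.hasDerivAt
  have hk : ∀ z ∈ Metric.ball x r,
      HasDerivAt (fun t => (w t).2) (-Q z / 2 * (w z).1) z := fun z hz => by
    simpa [A] using (hw z hz).hasFDerivAt.snd.hasDerivAt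
  have hne : ∀ᶠ z in nhds x, (w z).1 ≠ 0 :=
    (hh x (Metric.mem_ball_self hr)).continuousAt.eventually_ne (by simp [hwx])
  obtain ⟨s, hs, hsV⟩ :=
    Metric.eventually_nhds_iff_ball.1 (hne.and (Metric.ball_mem_nhds x hr))
  have hinv : DifferentiableOn ℂ (fun z => ((w z).1 ^ 2)⁻¹) (Metric.ball x s) := fun z hz =>
    (((hh z (hsV z hz).2).differentiableAt.fun_pow 2).fun_inv
      (pow_ne_zero 2 (hsV z hz).1)).differentiableWithinAt
  obtain ⟨f, hf⟩ := hinv.isExactOn_ball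
  refine ⟨Metric.ball x s, Metric.isOpen_ball, Metric.mem_ball_self hs,
    fun z hz => hrU (hsV z hz).2, f,
    fun z hz => (hf z hz).differentiableAt.differentiableWithinAt, fun z hz => ?_,
    fun z hz => ?_⟩
  · rw [(hf z hz).deriv]
    exact inv_ne_zero (pow_ne_zero 2 (hsV z hz).1)
  · rw [schwarzian_eq_of_hasDerivAt_inv_sq Metric.isOpen_ball hf
      (fun y hy => hh y (hsV y hy).2) (fun y hy => (hsV y hy).1) hz (hk z (hsV z hz).2)]
    ring
end
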